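/- arXiv:2303.08855 — 3 statements merged into one kernel-verified Lean document; each statement's English description precedes it below -/
import Mathlib

section
/- Suppose f(z) = ∑_{n=0}^∞ a_n z^n is holomorphic on the unit disk with |f(z)| ≤ 1 for all |z| < 1. Then for every N ≥ 1 and r ∈ [0,1), with t = ⌊(N−1)/2⌋: ∑_{n=N}^∞ |a_n| r^n + sgn(t)·∑_{n=1}^t |a_n|²·r^N/(1−r) + (1/(1+|a₀|) + r/(1−r))·∑_{n=t+1}^∞ |a_n|² r^{2n} ≤ (1 − |a₀|²)·r^N/(1−r). -/
open Finset Polynomial in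
/-- Multiplication by a polynomial bounded by one on the circle contracts the coefficient norm. -/
lemma aux_poly (P : ℂ[X]) (hP : ∀ z : ℂ, ‖z‖ = 1 → ‖P.eval z‖ ≤ 1) (G : ℕ → ℂ) (M : ℕ) :
    ∑ k ∈ range M, ‖∑ j ∈ range (k + 1), G j * P.coeff (k - j)‖ ^ 2 ≤ ∑ k ∈ range M, ‖G k‖ ^ 2 := by
  classical
  set g : ℂ[X] := ∑ i ∈ range M, monomial i (G i) with hg
  have hgc : ∀ k, g.coeff k = if k < M then G k else 0 := by
    intro k
    simp [hg, coeff_monomial]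
  have h1 : ∑ i ∈ g.support, ‖g.coeff i‖ ^ 2 = ∑ k ∈ range M, ‖G k‖ ^ 2 := by
    have hs : g.support ⊆ range M := by
      intro k hk
      rw [mem_support_iff, hgc] at hk
      by_contra h
      simp at h
      exact hk (by simp [h])
    rw [sum_subset hs (by
      intro x _ hx
      simp [notMem_support_iff.mp hx])]
    refine sum_congr rfl fun k hk => ?_
    rw [hgc, if_pos (mem_range.mp hk)]
  have h2 : ∑ k ∈ range M, ‖∑ j ∈ range (k + 1), G j * P.coeff (k - j)‖ ^ 2
      ≤ ∑ i ∈ (g * P).support, ‖(g * P).coeff i‖ ^ 2 := by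
    have : ∀ k ∈ range M, ‖∑ j ∈ range (k + 1), G j * P.coeff (k - j)‖ ^ 2
        = ‖(g * P).coeff k‖ ^ 2 := by
      intro k hk
      rw [coeff_mul, Nat.sum_antidiagonal_eq_sum_range_succ (fun i j => g.coeff i * P.coeff j)]
      congr 2
      refine sum_congr rfl fun j hj => ?_
      rw [hgc, if_pos]
      simp at hk hj
      omega
    rw [sum_congr rfl this]
    calc _ ≤ ∑ i ∈ (g * P).support ∪ range M, ‖(g * P).coeff i‖ ^ 2 :=
          sum_le_sum_of_subset_of_nonneg subset_union_right (by intros; positivity)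
      _ = _ := by
          symm
          apply sum_subset subset_union_left
          intro x _ hx
          simp [notMem_support_iff.mp hx]
  rw [← h1]
  refine h2.trans ?_
  rw [sum_sq_norm_coeff_eq_circleAverage, sum_sq_norm_coeff_eq_circleAverage]
  have hc : ∀ Q : ℂ[X], CircleIntegrable (fun θ ↦ ‖Q.eval θ‖ ^ 2) 0 1 := by
    intro Q
    apply ContinuousOn.circleIntegrable'
    exact ((Q.continuous.norm).pow 2).continuousOn
  apply Real.circleAverage_mono (hc _) (hc _)
  intro z hz
  have hz1 : ‖z‖ = 1 := by simpa using hz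
  simp only [eval_mul, norm_mul, mul_pow]
  have := hP z hz1
  have h3 : ‖P.eval z‖ ^ 2 ≤ 1 := pow_le_one₀ (norm_nonneg _) this
  nlinarith [sq_nonneg ‖g.eval z‖]

open Finset Polynomial Filter Topology in
lemma aux_contr (f : ℂ → ℂ) (a : ℕ → ℂ)
    (hf : ∀ z : ℂ, ‖z‖ < 1 → HasSum (fun n : ℕ => a n * z ^ n) (f z))
    (hb : ∀ z : ℂ, ‖z‖ < 1 → ‖f z‖ ≤ 1) (G : ℕ → ℂ) (M : ℕ) :
    ∑ k ∈ range M, ‖∑ j ∈ range (k + 1), G j * a (k - j)‖ ^ 2 ≤ ∑ k ∈ range M, ‖G k‖ ^ 2 := by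
  have key : ∀ s : ℝ, 0 < s → s < 1 →
      ∑ k ∈ range M, ‖∑ j ∈ range (k + 1), G j * (s ^ (k - j + 1) * a (k - j))‖ ^ 2
        ≤ ∑ k ∈ range M, ‖G k‖ ^ 2 := by
    intro s hs0 hs1
    have hsum : Summable (fun n => ‖a n‖ * s ^ n) := by
      have := (hf s (by simpa [abs_of_pos hs0] using hs1)).summable.norm
      simpa [abs_of_pos hs0] using this
    have htail := _root_.tendsto_sum_nat_add (fun n => ‖a n‖ * s ^ n)
    have hε : 0 < s⁻¹ - 1 := by
      have := (one_lt_inv₀ hs0).mpr hs1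
      linarith
    obtain ⟨K, hK, hKM⟩ := ((htail.eventually (gt_mem_nhds hε)).and
      (eventually_ge_atTop M)).exists
    set P : ℂ[X] := ∑ i ∈ range K, monomial i ((s : ℂ) ^ (i + 1) * a i) with hPdef
    have hPc : ∀ k, k < K → P.coeff k = (s : ℂ) ^ (k + 1) * a k := by
      intro k hk
      simp only [hPdef, finsetSum_coeff, coeff_monomial]
      simp [hk]
    have hP : ∀ z : ℂ, ‖z‖ = 1 → ‖P.eval z‖ ≤ 1 := by
      intro z hz
      have hnorm : ‖(s : ℂ) * z‖ < 1 := by simpa [abs_of_pos hs0, hz] using hs1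
      have hfs := hf _ hnorm
      have e1 : P.eval z = s * ∑ i ∈ range K, a i * (s * z) ^ i := by
        simp only [hPdef, eval_finsetSum, eval_monomial, mul_sum]
        refine sum_congr rfl fun i _ => ?_
        ring
      have e2 := hfs.summable.sum_add_tsum_nat_add K
      rw [hfs.tsum_eq] at e2
      have e3 : ‖∑' i, a (i + K) * (s * z) ^ (i + K)‖ ≤ ∑' i, ‖a (i + K)‖ * s ^ (i + K) := by
        have hn : ∀ i, ‖a (i + K) * (s * z) ^ (i + K)‖ = ‖a (i + K)‖ * s ^ (i + K) := by
          intro i; simp [abs_of_pos hs0, hz]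
        have := norm_tsum_le_tsum_norm (f := fun i => a (i + K) * (s * z) ^ (i + K)) (by
          simp_rw [hn]
          exact (summable_nat_add_iff K).mpr hsum)
        simpa only [hn] using this
      have e4 : ‖∑ i ∈ range K, a i * (s * z) ^ i‖ ≤ s⁻¹ := by
        rw [eq_sub_of_add_eq e2]
        calc _ ≤ ‖f (s * z)‖ + ‖∑' i, a (i + K) * (s * z) ^ (i + K)‖ := norm_sub_le _ _
          _ ≤ 1 + (s⁻¹ - 1) := add_le_add (hb _ hnorm) (e3.trans hK.le)
          _ = s⁻¹ := by ring
      rw [e1, norm_mul]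
      calc _ ≤ s * s⁻¹ := by
            gcongr
            simp [abs_of_pos hs0]
        _ = 1 := mul_inv_cancel₀ hs0.ne'
    refine le_trans (le_of_eq ?_) (aux_poly P hP G M)
    refine sum_congr rfl fun k hk => ?_
    congr 2
    refine sum_congr rfl fun j hj => ?_
    rw [hPc]
    simp at hk
    omega
  have hcont : Continuous (fun s : ℝ =>
      ∑ k ∈ range M, ‖∑ j ∈ range (k + 1), G j * ((s : ℂ) ^ (k - j + 1) * a (k - j))‖ ^ 2) := by
    fun_prop
  have hlim := (hcont.tendsto 1).mono_left (nhdsWithin_le_nhds (s := Set.Iio 1))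
  have := le_of_tendsto hlim (by
    filter_upwards [Ioo_mem_nhdsLT (show (0:ℝ) < 1 by norm_num)] with s hs
    exact key s hs.1 hs.2)
  simpa using this

open Finset in
lemma aux_block (f : ℂ → ℂ) (a : ℕ → ℂ)
    (hf : ∀ z : ℂ, ‖z‖ < 1 → HasSum (fun n : ℕ => a n * z ^ n) (f z))
    (hb : ∀ z : ℂ, ‖z‖ < 1 → ‖f z‖ ≤ 1) (w : ℕ → ℂ) (m p : ℕ) :
    ∑ k ∈ range (m + 1), ‖a k‖ ^ 2 +
      ∑ k ∈ range p, ‖a (m + 1 + k) + ∑ j ∈ range (k + 1), w j * a (k - j)‖ ^ 2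
      ≤ 1 + ∑ k ∈ range p, ‖w k‖ ^ 2 := by
  set G : ℕ → ℂ := fun k => if k = 0 then 1 else if k < m + 1 then 0 else w (k - (m + 1)) with hG
  have h := aux_contr f a hf hb G (m + 1 + p)
  have hG0 : G 0 = 1 := by simp [hG]
  have hG1 : ∀ k, k < m → G (k + 1) = 0 := by intro k hk; simp [hG, hk]
  have hG2 : ∀ k, G (m + 1 + k) = w k := by
    intro k
    simp only [hG]
    rw [if_neg (by omega), if_neg (by omega), Nat.add_sub_cancel_left]
  rw [sum_range_add _ (m + 1) p, sum_range_add _ (m + 1) p] at h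
  have e1 : ∑ k ∈ range (m + 1), ‖G k‖ ^ 2 = 1 := by
    rw [sum_range_succ', hG0, sum_eq_zero]
    · simp
    · intro k hk
      simp [hG1 k (mem_range.mp hk)]
  have e3 : ∀ k ≤ m, ∀ q : ℕ → ℂ, ∑ j ∈ range (k + 1), G j * q j = q 0 := by
    intro k hk q
    rw [sum_range_succ', hG0, sum_eq_zero]
    · simp
    · intro i hi
      rw [hG1 i (by simp at hi; omega), zero_mul]
  have e2 : ∑ k ∈ range (m + 1), ‖∑ j ∈ range (k + 1), G j * a (k - j)‖ ^ 2
      = ∑ k ∈ range (m + 1), ‖a k‖ ^ 2 := by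
    refine sum_congr rfl fun k hk => ?_
    rw [e3 k (by simp at hk; omega) (fun j => a (k - j))]
    simp
  rw [e1, e2] at h
  simp only [hG2] at h
  convert h using 5 with k hk
  rw [add_assoc (m + 1) k 1, sum_range_add _ (m + 1) (k + 1), e3 m le_rfl (fun j => a (m + 1 + k - j))]
  congr 1
  refine sum_congr rfl fun j hj => ?_
  rw [hG2]
  congr 2
  omega

lemma aux_phase (z : ℂ) : ∃ w : ℂ, ‖w‖ = 1 ∧ z = ‖z‖ * w := by
  by_cases h : z = 0
  · exact ⟨1, by simp, by simp [h]⟩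
  · refine ⟨z / ‖z‖, by simp [h], ?_⟩
    have : (‖z‖ : ℂ) ≠ 0 := by simpa using h
    field_simp

lemma aux_conj (z : ℂ) : (starRingEnd ℂ) z * z = ((‖z‖ ^ 2 : ℝ) : ℂ) := by
  rw [mul_comm, Complex.mul_conj, Complex.normSq_eq_norm_sq]

open Finset in
lemma aux_odd (f : ℂ → ℂ) (a : ℕ → ℂ)
    (hf : ∀ z : ℂ, ‖z‖ < 1 → HasSum (fun n : ℕ => a n * z ^ n) (f z))
    (hb : ∀ z : ℂ, ‖z‖ < 1 → ‖f z‖ ≤ 1) (n : ℕ) :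
    ‖a (2 * n + 1)‖ + ∑ k ∈ range (n + 1), ‖a k‖ ^ 2 ≤ 1 := by
  obtain ⟨ω, hω, ha⟩ := aux_phase (a (2 * n + 1))
  have h := aux_block f a hf hb (fun j => ω * (starRingEnd ℂ) (a (n - j))) n (n + 1)
  set c := ∑ k ∈ range (n + 1), ‖a k‖ ^ 2 with hc
  have hc0 : 0 ≤ c := by positivity
  have e1 : ∑ k ∈ range (n + 1), ‖ω * (starRingEnd ℂ) (a (n - k))‖ ^ 2 = c := by
    rw [hc, ← sum_range_reflect (fun k => ‖a k‖ ^ 2)]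
    refine sum_congr rfl fun k hk => ?_
    simp [hω]
  have e2 : ‖a (n + 1 + n) + ∑ j ∈ range (n + 1), ω * (starRingEnd ℂ) (a (n - j)) * a (n - j)‖
      = ‖a (2 * n + 1)‖ + c := by
    have : a (n + 1 + n) + ∑ j ∈ range (n + 1), ω * (starRingEnd ℂ) (a (n - j)) * a (n - j)
        = ((‖a (2 * n + 1)‖ + c : ℝ) : ℂ) * ω := by
      rw [show n + 1 + n = 2 * n + 1 by ring]
      conv_lhs => rw [ha]
      simp only [mul_assoc, aux_conj]
      rw [← mul_sum, hc, ← sum_range_reflect (fun k => ‖a k‖ ^ 2)]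
      push_cast
      ring
    rw [this, norm_mul, hω, mul_one, Complex.norm_real, Real.norm_of_nonneg (by positivity)]
  rw [e1, sum_range_succ _ n] at h
  simp only [e2] at h
  have h0 : 0 ≤ ∑ k ∈ range n, ‖a (n + 1 + k) + ∑ j ∈ range (k + 1),
    ω * (starRingEnd ℂ) (a (n - j)) * a (k - j)‖ ^ 2 := by positivity
  have h1 : (‖a (2 * n + 1)‖ + c) ^ 2 ≤ 1 := by linarith
  exact (abs_le_of_sq_le_sq' (by simpa using h1) zero_le_one).2

open Finset in
lemma aux_even (f : ℂ → ℂ) (a : ℕ → ℂ)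
    (hf : ∀ z : ℂ, ‖z‖ < 1 → HasSum (fun n : ℕ => a n * z ^ n) (f z))
    (hb : ∀ z : ℂ, ‖z‖ < 1 → ‖f z‖ ≤ 1) (n : ℕ) :
    ‖a (2 * (n + 1))‖ + ∑ k ∈ range (n + 1), ‖a k‖ ^ 2
      + 1 / (1 + ‖a 0‖) * ‖a (n + 1)‖ ^ 2 ≤ 1 := by
  obtain ⟨ω, hω, ha⟩ := aux_phase (a (2 * (n + 1)))
  set s : ℝ := 1 / (1 + ‖a 0‖) with hs
  have hs0 : 0 < s := by positivity
  have hs1 : 1 - s * ‖a 0‖ = s := by rw [hs]; field_simp; ring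
  set W : ℕ → ℂ := fun j => if j = 0 then ω * s * (starRingEnd ℂ) (a (n + 1))
    else ω * (starRingEnd ℂ) (a (n + 1 - j)) with hW
  have hW0 : W 0 = ω * s * (starRingEnd ℂ) (a (n + 1)) := by simp [hW]
  have hW1 : ∀ j, W (j + 1) = ω * (starRingEnd ℂ) (a (n - j)) := by intro j; simp [hW]
  have h := aux_block f a hf hb W n (n + 2)
  set c := ∑ k ∈ range (n + 1), ‖a k‖ ^ 2 with hc
  have hc0 : 0 ≤ c := by positivity
  have e1 : ∑ k ∈ range (n + 2), ‖W k‖ ^ 2 = c + s ^ 2 * ‖a (n + 1)‖ ^ 2 := by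
    rw [sum_range_succ', hW0, hc, ← sum_range_reflect (fun k => ‖a k‖ ^ 2)]
    congr 1
    · refine sum_congr rfl fun k hk => ?_
      simp [hW1, hω]
    · simp [hω, mul_pow]
  have e2 : ‖a (n + 1 + (n + 1)) + ∑ j ∈ range (n + 1 + 1), W j * a (n + 1 - j)‖
      = ‖a (2 * (n + 1))‖ + c + s * ‖a (n + 1)‖ ^ 2 := by
    have : a (n + 1 + (n + 1)) + ∑ j ∈ range (n + 1 + 1), W j * a (n + 1 - j)
        = ((‖a (2 * (n + 1))‖ + c + s * ‖a (n + 1)‖ ^ 2 : ℝ) : ℂ) * ω := by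
      rw [show n + 1 + (n + 1) = 2 * (n + 1) by ring, sum_range_succ', hW0]
      conv_lhs => rw [ha]
      simp only [hW1, Nat.add_sub_add_right, Nat.sub_zero, mul_assoc, aux_conj]
      rw [← mul_sum, hc, ← sum_range_reflect (fun k => ‖a k‖ ^ 2)]
      push_cast
      ring
    rw [this, norm_mul, hω, mul_one, Complex.norm_real, Real.norm_of_nonneg (by positivity)]
  have e3 : s * ‖a (n + 1)‖ ≤ ‖a (n + 1 + 0) + ∑ j ∈ range (0 + 1), W j * a (0 - j)‖ := by
    simp only [zero_add, sum_range_one, hW0, add_zero, Nat.sub_zero]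
    have := norm_sub_le_norm_add (a (n + 1)) (ω * s * (starRingEnd ℂ) (a (n + 1)) * a 0)
    have e : ‖ω * s * (starRingEnd ℂ) (a (n + 1)) * a 0‖ = s * ‖a (n + 1)‖ * ‖a 0‖ := by
      simp [hω, abs_of_pos hs0]
    rw [e] at this
    refine le_trans (le_of_eq ?_) this
    conv_lhs => rw [← hs1]
    ring
  rw [e1, sum_range_succ _ (n + 1), sum_range_succ' _ n] at h
  simp only [e2] at h
  have h0 : 0 ≤ ∑ k ∈ range n, ‖a (n + 1 + (k + 1)) + ∑ j ∈ range (k + 1 + 1),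
    W j * a (k + 1 - j)‖ ^ 2 := by positivity
  have e4 := pow_le_pow_left₀ (by positivity) e3 2
  rw [mul_pow] at e4
  have h1 : (‖a (2 * (n + 1))‖ + c + s * ‖a (n + 1)‖ ^ 2) ^ 2 ≤ 1 := by linarith
  exact (abs_le_of_sq_le_sq' (by simpa using h1) zero_le_one).2

open Finset Filter Topology in
theorem stmt_12 (f : ℂ → ℂ) (a : ℕ → ℂ)
    (hf : ∀ z : ℂ, ‖z‖ < 1 → HasSum (fun n : ℕ => a n * z ^ n) (f z))
    (hb : ∀ z : ℂ, ‖z‖ < 1 → ‖f z‖ ≤ 1)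
    (N : ℕ) (hN : 1 ≤ N) (r : ℝ) (hr : r ∈ Set.Ico (0:ℝ) 1) :
    (∑' n : ℕ, ‖a (n + N)‖ * r ^ (n + N)) +
      (if (N - 1) / 2 = 0 then (0:ℝ) else 1) *
        (∑ n ∈ Finset.Icc 1 ((N - 1) / 2), ‖a n‖ ^ 2) * r ^ N / (1 - r) +
      (1 / (1 + ‖a 0‖) + r / (1 - r)) *
        ∑' n : ℕ, ‖a (n + ((N - 1) / 2 + 1))‖ ^ 2 * r ^ (2 * (n + ((N - 1) / 2 + 1))) ≤
    (1 - ‖a 0‖ ^ 2) * r ^ N / (1 - r) := by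
  obtain ⟨hr0, hr1⟩ := hr
  have h1r : 0 < 1 - r := by linarith
  set κ : ℝ := 1 / (1 + ‖a 0‖) with hκ
  have hκ0 : 0 ≤ κ := by positivity
  have hodd := aux_odd f a hf hb
  have heven := aux_even f a hf hb
  set S : ℕ → ℝ := fun t => ∑ k ∈ range (t + 1), ‖a k‖ ^ 2 with hS
  set B : ℕ → ℝ := fun n => ‖a n‖ ^ 2 * r ^ (2 * n) with hB
  set T : ℕ → ℝ := fun t => ∑' n, B (n + (t + 1)) with hT
  have hS1 : ∀ t, S t ≤ 1 := fun t => by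
    have := hodd t
    have := norm_nonneg (a (2 * t + 1))
    simp only [hS]; linarith
  have ha1 : ∀ n, ‖a n‖ ^ 2 ≤ 1 := fun n => by
    refine le_trans ?_ (hS1 n)
    exact single_le_sum (f := fun k => ‖a k‖ ^ 2) (fun _ _ => by positivity) (by simp)
  have hBs : Summable B := by
    refine Summable.of_nonneg_of_le (fun n => by positivity) (fun n => ?_)
      (summable_geometric_of_lt_one (r := r ^ 2) (by positivity) (by nlinarith))
    simp only [hB, pow_mul]
    have : 0 ≤ (r ^ 2) ^ n := by positivity
    nlinarith [ha1 n]
  have hTs : ∀ t, T t = B (t + 1) + T (t + 1) := by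
    intro t
    have := ((summable_nat_add_iff (t + 1)).mpr hBs).tsum_eq_zero_add
    simp only [hT]
    rw [this, zero_add]
    congr 2
    ext n
    congr 1
    ring
  have hT0 : Tendsto T atTop (𝓝 0) :=
    (_root_.tendsto_sum_nat_add B).comp (tendsto_add_atTop_nat 1)
  set F : ℕ → ℝ := fun n =>
    (1 - S ((n - 1) / 2)) * r ^ n / (1 - r) - (κ + r / (1 - r)) * T ((n - 1) / 2) with hF
  have hstep : ∀ n, 1 ≤ n → ‖a n‖ * r ^ n ≤ F n - F (n + 1) := by
    intro n hn
    have hrn : 0 ≤ r ^ n := by positivity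
    obtain ⟨m, rfl | rfl⟩ : ∃ m, n = 2 * m + 1 ∨ n = 2 * (m + 1) :=
      ⟨(n - 1) / 2, by omega⟩
    · have q1 : (2 * m + 1 - 1) / 2 = m := by omega
      have q2 : (2 * m + 1 + 1 - 1) / 2 = m := by omega
      have e : F (2 * m + 1) - F (2 * m + 1 + 1) = (1 - S m) * r ^ (2 * m + 1) := by
        simp only [hF, q1, q2]
        field_simp
        ring
      rw [e]
      apply mul_le_mul_of_nonneg_right _ hrn
      have := hodd m
      simp only [hS]; linarith
    · have q1 : (2 * (m + 1) - 1) / 2 = m := by omega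
      have q2 : (2 * (m + 1) + 1 - 1) / 2 = m + 1 := by omega
      have e : F (2 * (m + 1)) - F (2 * (m + 1) + 1)
          = (1 - S m - κ * ‖a (m + 1)‖ ^ 2) * r ^ (2 * (m + 1)) := by
        have hS' : S (m + 1) = S m + ‖a (m + 1)‖ ^ 2 := by
          simp only [hS]; rw [sum_range_succ]
        simp only [hF, q1, q2]
        rw [hTs m, hS']
        simp only [hB]
        field_simp
        ring
      rw [e]
      apply mul_le_mul_of_nonneg_right _ hrn
      have := heven m
      simp only [hS]; linarith
  have hpart : ∀ M, ∑ n ∈ range M, ‖a (n + N)‖ * r ^ (n + N) ≤ F N - F (M + N) := by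
    intro M
    induction M with
    | zero => simp
    | succ M ih =>
      rw [sum_range_succ]
      have := hstep (M + N) (by omega)
      rw [show M + 1 + N = M + N + 1 by ring]
      linarith
  have hpart2 : ∀ M, ∑ n ∈ range M, ‖a (n + N)‖ * r ^ (n + N)
      ≤ F N + (κ + r / (1 - r)) * T ((M + N - 1) / 2) := by
    intro M
    refine (hpart M).trans ?_
    have : 0 ≤ (1 - S ((M + N - 1) / 2)) * r ^ (M + N) / (1 - r) := by
      have := sub_nonneg.mpr (hS1 ((M + N - 1) / 2))
      positivity
    simp only [hF]
    linarith
  have hsum : Summable (fun n => ‖a (n + N)‖ * r ^ (n + N)) := by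
    have := (hf r (by simpa [abs_of_nonneg hr0] using hr1)).summable.norm
    have h2 : Summable (fun n => ‖a n‖ * r ^ n) := by simpa [abs_of_nonneg hr0] using this
    exact (summable_nat_add_iff N).mpr h2
  have hfin : ∑' n, ‖a (n + N)‖ * r ^ (n + N) ≤ F N := by
    have hm : Tendsto (fun M : ℕ => (M + N - 1) / 2) atTop atTop := by
      refine tendsto_atTop.mpr fun b => ?_
      filter_upwards [eventually_ge_atTop (2 * b + 1)] with M hM
      omega
    have hl := ((hT0.comp hm).const_mul (κ + r / (1 - r))).const_add (F N)
    rw [mul_zero, add_zero] at hl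
    exact le_of_tendsto_of_tendsto' hsum.hasSum.tendsto_sum_nat hl hpart2
  have hsgn : (if (N - 1) / 2 = 0 then (0:ℝ) else 1) *
      (∑ n ∈ Finset.Icc 1 ((N - 1) / 2), ‖a n‖ ^ 2) = S ((N - 1) / 2) - ‖a 0‖ ^ 2 := by
    have h1 : S ((N - 1) / 2) = ∑ n ∈ Finset.Icc 1 ((N - 1) / 2), ‖a n‖ ^ 2 + ‖a 0‖ ^ 2 := by
      simp only [hS]
      rw [sum_range_succ', range_eq_Ico, Finset.sum_Ico_add' (fun k => ‖a k‖ ^ 2) 0 _ 1]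
      rfl
    rw [h1]
    split_ifs with h0
    · simp [h0]
    · ring
  rw [hsgn]
  change _ + _ + (κ + r / (1 - r)) * T ((N - 1) / 2) ≤ _
  have e : F N = (1 - ‖a 0‖ ^ 2) * r ^ N / (1 - r)
      - (S ((N - 1) / 2) - ‖a 0‖ ^ 2) * r ^ N / (1 - r)
      - (κ + r / (1 - r)) * T ((N - 1) / 2) := by
    simp only [hF]
    ring
  linarith
end

section
/- Suppose f(z) = ∑_{n=0}^∞ a_n z^n is holomorphic on the unit disk with |f(z)| ≤ 1 for all |z| < 1. Then for all r ∈ [0,1): ∑_{n=1}^∞ |a_n| r^n + (1/(1+|a₀|) + r/(1−r))·∑_{n=1}^∞ |a_n|² r^{2n} ≤ (1 − |a₀|²)·r/(1−r). -/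
open Finset

lemma quad_opt (X P : ℝ) (hX : 0 ≤ X) (_hP : 0 ≤ P)
    (h : ∀ τ : ℝ, 0 ≤ τ → X ^ 2 * (1 + τ * P) ^ 2 ≤ τ ^ 2 * P * X ^ 2 + (1 - P)) : X ≤ 1 - P := by
  have h0 := h 0 le_rfl
  have hP1 : 0 ≤ 1 - P := by nlinarith [sq_nonneg X]
  rcases hP1.eq_or_lt with h1 | h1
  · rw [← h1] at h0 ⊢
    nlinarith
  · have h2 := h (1 / (1 - P)) (by positivity)
    have e1 : X ^ 2 * (1 + 1 / (1 - P) * P) ^ 2 - (1 / (1 - P)) ^ 2 * P * X ^ 2 = X ^ 2 / (1 - P) := by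
      field_simp; ring
    have h3 : X ^ 2 / (1 - P) ≤ 1 - P := by linarith
    rw [div_le_iff₀ h1] at h3
    nlinarith

/-- purely algebraic part -/
lemma even_alg (a0 an aN : ℂ) (S : ℝ) (hS : ‖a0‖ ^ 2 ≤ S)
    (h : ∀ β T : ℂ, S + ‖an + β * a0‖ ^ 2 + ‖aN + β * an + T * S‖ ^ 2 ≤ 1 + ‖β‖ ^ 2 + ‖T‖ ^ 2 * S) :
    ‖aN‖ ≤ 1 - S - ‖an‖ ^ 2 / (1 + ‖a0‖) := by
  have hS0 : 0 ≤ S := le_trans (sq_nonneg _) hS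
  have h0 := h 0 0
  simp at h0
  have hD : 0 ≤ 1 - S := by nlinarith [sq_nonneg ‖an‖, sq_nonneg ‖aN‖]
  rcases hD.eq_or_lt with hD | hD
  · have h1 : ‖an‖ ^ 2 = 0 := by nlinarith [sq_nonneg ‖an‖, sq_nonneg ‖aN‖]
    have h2 : ‖aN‖ ^ 2 = 0 := by nlinarith [sq_nonneg ‖an‖, sq_nonneg ‖aN‖]
    rw [h1, ← hD]; simp at h2 ⊢; exact h2
  set D := 1 - S with hDdef
  have hDc : (D : ℂ) ≠ 0 := by exact_mod_cast hD.ne'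
  have step1 : ∀ β : ℂ, ‖aN + β * an‖ ^ 2 ≤ D * (D + ‖β‖ ^ 2 - ‖an + β * a0‖ ^ 2) := by
    intro β
    have := h β ((aN + β * an) / D)
    have e : aN + β * an + (aN + β * an) / D * S = (aN + β * an) / D := by
      field_simp
      have : (S : ℂ) = 1 - D := by rw [hDdef]; push_cast; ring
      rw [this]; ring
    rw [e, norm_div, Complex.norm_real, Real.norm_of_nonneg hD.le] at this
    have e2 : (‖aN + β * an‖ / D) ^ 2 * D = ‖aN + β * an‖ ^ 2 / D := by field_simp
    have h3 : ‖aN + β * an‖ ^ 2 / D ≤ D + ‖β‖ ^ 2 - ‖an + β * a0‖ ^ 2 := by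
      rw [← e2]
      have : S = 1 - D := by rw [hDdef]; ring
      nlinarith
    rw [div_le_iff₀ hD] at h3
    linarith
  set e := 1 - ‖a0‖ ^ 2 with he
  have hepos : 0 < e := by linarith
  have hec : (e : ℂ) ≠ 0 := by exact_mod_cast hepos.ne'
  set Q := aN + an ^ 2 * (starRingEnd ℂ) a0 / e with hQ
  have step2 : ∀ γ : ℂ, ‖Q + γ * an‖ ^ 2 ≤ D * (e * ‖γ‖ ^ 2 + D - ‖an‖ ^ 2 / e) := by
    intro γ
    have := step1 (γ + an * (starRingEnd ℂ) a0 / e)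
    have e1 : aN + (γ + an * (starRingEnd ℂ) a0 / e) * an = Q + γ * an := by rw [hQ]; ring
    rw [e1] at this
    have e2 : ‖γ + an * (starRingEnd ℂ) a0 / e‖ ^ 2 - ‖an + (γ + an * (starRingEnd ℂ) a0 / e) * a0‖ ^ 2
        = e * ‖γ‖ ^ 2 - ‖an‖ ^ 2 / e := by
      have e3 : an + (γ + an * (starRingEnd ℂ) a0 / e) * a0 = γ * a0 + an / e := by
        field_simp
        have : (starRingEnd ℂ) a0 * a0 = 1 - e := by
          rw [mul_comm, Complex.mul_conj, Complex.normSq_eq_norm_sq, he]; push_cast; ring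
        linear_combination an * this
      rw [e3]
      rw [div_eq_mul_inv, div_eq_mul_inv, ← Complex.ofReal_inv]
      have he' : e = 1 - (a0.re ^ 2 + a0.im ^ 2) := by
        rw [he, ← Complex.normSq_eq_norm_sq, Complex.normSq_apply]; ring
      simp only [← Complex.normSq_eq_norm_sq, Complex.normSq_apply]
      simp
      have hi : e⁻¹ * e = 1 := inv_mul_cancel₀ hepos.ne'
      rw [div_eq_mul_inv]
      generalize e⁻¹ = i at *
      have hq : a0.re ^ 2 + a0.im ^ 2 = 1 - e := by linarith
      linear_combination ((i^2 * (an.re^2+an.im^2)) - (γ.re^2+γ.im^2)) * hq + (-i * (an.re^2+an.im^2)) * hi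
    calc _ ≤ _ := this
      _ = _ := by rw [show e * ‖γ‖ ^ 2 + D - ‖an‖ ^ 2 / e = D + (e * ‖γ‖ ^ 2 - ‖an‖ ^ 2 / e) by ring, ← e2]; ring
  have step3 : ‖Q‖ / D ≤ 1 - ‖an‖ ^ 2 / (D * e) := by
    apply quad_opt _ _ (by positivity) (by positivity)
    intro τ hτ
    have := step2 ((τ / (D * e) : ℝ) * (starRingEnd ℂ) an * Q)
    have e1 : Q + ((τ / (D * e) : ℝ) * (starRingEnd ℂ) an * Q) * an = Q * ((1 + τ * (‖an‖ ^ 2 / (D * e)) : ℝ) : ℂ) := by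
      have : (starRingEnd ℂ) an * an = (‖an‖ ^ 2 : ℝ) := by
        rw [mul_comm, Complex.mul_conj, Complex.normSq_eq_norm_sq]
      push_cast at this ⊢
      linear_combination (Q * (τ / (D * e))) * this
    rw [e1, norm_mul, norm_mul, norm_mul, Complex.norm_real, Complex.norm_real, Real.norm_of_nonneg (by positivity),
      Real.norm_of_nonneg (by positivity), RCLike.norm_conj] at this
    have h5 : (‖Q‖ / D) ^ 2 * (1 + τ * (‖an‖ ^ 2 / (D * e))) ^ 2 = (‖Q‖ * (1 + τ * (‖an‖ ^ 2 / (D * e)))) ^ 2 / D ^ 2 := by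
      ring
    rw [h5, div_le_iff₀ (by positivity)]
    refine this.trans (le_of_eq ?_)
    field_simp
    ring
  have step4 : ‖Q‖ ≤ D - ‖an‖ ^ 2 / e := by
    rw [div_le_iff₀ hD] at step3
    refine step3.trans (le_of_eq ?_)
    field_simp
  have : ‖aN‖ ≤ ‖Q‖ + ‖an‖ ^ 2 * ‖a0‖ / e := by
    have : aN = Q - an ^ 2 * (starRingEnd ℂ) a0 / e := by rw [hQ]; ring
    calc ‖aN‖ = ‖Q - an ^ 2 * (starRingEnd ℂ) a0 / e‖ := by rw [← this]
      _ ≤ _ := norm_sub_le _ _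
      _ = _ := by
        rw [norm_div, norm_mul, norm_pow, RCLike.norm_conj, Complex.norm_real, Real.norm_of_nonneg hepos.le]
  have e5 : ‖an‖ ^ 2 / (1 + ‖a0‖) = ‖an‖ ^ 2 / e - ‖an‖ ^ 2 * ‖a0‖ / e := by
    have : 0 ≤ ‖a0‖ := norm_nonneg _
    field_simp
    rw [he]; ring
  rw [e5]; linarith

open MeasureTheory in
lemma bessel_le (c v : ℕ → ℂ) (N : ℕ) (hcs : Summable fun m => ‖c m‖)
    (hle : ∀ w : ℂ, ‖w‖ = 1 → ‖∑' m, c m * w ^ m‖ ≤ ‖∑ j ∈ range (N + 1), v j * w ^ j‖) :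
    ∑ m ∈ range (N + 1), ‖c m‖ ^ 2 ≤ ∑ j ∈ range (N + 1), ‖v j‖ ^ 2 := by
  have : Fact (0 < (1 : ℝ)) := ⟨one_pos⟩
  have hsF : Summable fun m : ℕ => c m • (fourier (m : ℤ) : C(AddCircle (1 : ℝ), ℂ)) := by
    apply Summable.of_norm
    have : (fun m : ℕ => ‖c m • (fourier (m : ℤ) : C(AddCircle (1 : ℝ), ℂ))‖) = fun m => ‖c m‖ := by
      funext m
      rw [norm_smul, fourier_norm, mul_one]
    rw [this]; exact hcs
  obtain ⟨P, hP⟩ : ∃ P : C(AddCircle (1 : ℝ), ℂ), P = ∑ j ∈ range (N + 1), v j • fourier (j : ℤ) := ⟨_, rfl⟩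
  obtain ⟨F, hF⟩ := hsF
  have hfour : ∀ (x : AddCircle (1 : ℝ)) (m : ℕ), fourier (m : ℤ) x = (fourier 1 x) ^ m := by
    intro x m
    induction m with
    | zero => simp
    | succ k ih => rw [Nat.cast_succ, fourier_add, ih, pow_succ]
  have hn1 : ∀ x : AddCircle (1 : ℝ), ‖(fourier 1 x : ℂ)‖ = 1 := by
    intro x; rw [fourier_apply]; exact Circle.norm_coe _
  have hle : ∀ x, ‖F x‖ ≤ ‖P x‖ := by
    intro x
    have hFx : HasSum (fun m : ℕ => c m * (fourier 1 x) ^ m) (F x) := by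
      have := ContinuousMap.hasSum_apply hF x
      simp only [ContinuousMap.coe_smul, Pi.smul_apply, smul_eq_mul, hfour] at this
      exact this
    have hPx : P x = ∑ j ∈ range (N + 1), v j * (fourier 1 x) ^ j := by
      simp only [hP, ContinuousMap.coe_sum, Finset.sum_apply, ContinuousMap.coe_smul, Pi.smul_apply,
        smul_eq_mul, hfour]
    have := hle _ (hn1 x)
    rwa [hFx.tsum_eq, ← hPx] at this
  obtain ⟨L, hL⟩ : ∃ L, L = ContinuousMap.toLp (E := ℂ) 2 (@AddCircle.haarAddCircle (1 : ℝ) _) ℂ := ⟨_, rfl⟩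
  have hnorm : ‖L F‖ ≤ ‖L P‖ := by
    rw [hL]
    apply Lp.norm_le_norm_of_ae_le
    filter_upwards [ContinuousMap.coeFn_toLp (E := ℂ) (p := 2) (𝕜 := ℂ) (@AddCircle.haarAddCircle (1 : ℝ) _) F,
      ContinuousMap.coeFn_toLp (E := ℂ) (p := 2) (𝕜 := ℂ) (@AddCircle.haarAddCircle (1 : ℝ) _) P] with x hx hy
    rw [hx, hy]; exact hle x
  have horth : Orthonormal ℂ (fun m : ℕ => L (fourier (m : ℤ))) := by
    rw [hL]
    exact (orthonormal_fourier (T := 1)).comp (fun m : ℕ => (m : ℤ)) Nat.cast_injective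
  have hLP : L P = ∑ j ∈ range (N + 1), v j • L (fourier (j : ℤ)) := by
    rw [hP, map_sum]
    refine sum_congr rfl fun k hk => ?_
    rw [map_smul]
  have hLF : HasSum (fun m : ℕ => c m • L (fourier (m : ℤ))) (L F) := by
    have := L.hasSum hF
    simp only [map_smul] at this
    exact this
  clear hL hle hF hP
  generalize L F = LF at *
  generalize L P = LP at *
  have hPn : ‖LP‖ ^ 2 = ∑ j ∈ range (N + 1), ‖v j‖ ^ 2 := by
    have := horth.inner_sum v v (range (N + 1))
    rw [← hLP, inner_self_eq_norm_sq_to_K] at this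
    have h2 : ((‖LP‖ ^ 2 : ℝ) : ℂ) = ((∑ j ∈ range (N + 1), ‖v j‖ ^ 2 : ℝ) : ℂ) := by
      push_cast
      refine Eq.trans this ?_
      refine sum_congr rfl fun k hk => ?_
      rw [Complex.conj_mul']
    exact_mod_cast h2
  have hin : ∀ m : ℕ, inner ℂ (L (fourier (m : ℤ))) LF = c m := by
    intro m
    have h3 := (innerSL ℂ (L (fourier (m : ℤ)))).hasSum hLF
    have h4 : HasSum (fun k : ℕ => inner ℂ (L (fourier (m : ℤ))) (c k • L (fourier (k : ℤ)))) (c m) := by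
      have h5 := hasSum_ite_eq m (c m)
      convert h5 using 2 with k
      rw [inner_smul_right, orthonormal_iff_ite.1 horth m k]
      by_cases h : k = m
      · simp [h]
      · simp [h, Ne.symm h]
    exact h3.unique h4
  have hbes := horth.sum_inner_products_le LF (s := range (N + 1))
  simp only [hin] at hbes
  calc _ ≤ _ := hbes
    _ ≤ ‖LP‖ ^ 2 := by gcongr
    _ = _ := hPn

lemma contr_rho (f : ℂ → ℂ) (a : ℕ → ℂ)
    (hf : ∀ z : ℂ, ‖z‖ < 1 → HasSum (fun n : ℕ => a n * z ^ n) (f z))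
    (hb : ∀ z : ℂ, ‖z‖ < 1 → ‖f z‖ ≤ 1) (u : ℕ → ℂ) (N : ℕ) (hu : ∀ j, N < j → u j = 0)
    (ρ : ℝ) (h0 : 0 ≤ ρ) (h1 : ρ < 1) :
    ∑ m ∈ range (N + 1), ‖(∑ k ∈ range (m + 1), u k * a (m - k)) * (ρ : ℂ) ^ m‖ ^ 2
      ≤ ∑ j ∈ range (N + 1), ‖u j * (ρ : ℂ) ^ j‖ ^ 2 := by
  have hρ : ‖(ρ : ℂ)‖ < 1 := by rw [Complex.norm_real, Real.norm_of_nonneg h0]; exact h1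
  have hpow : ∀ (z : ℂ) (m : ℕ), (∑ k ∈ range (m + 1), u k * a (m - k)) * z ^ m
      = ∑ k ∈ range (m + 1), (u k * z ^ k) * (a (m - k) * z ^ (m - k)) := by
    intro z m
    rw [sum_mul]
    refine sum_congr rfl fun k hk => ?_
    have h : z ^ m = z ^ k * z ^ (m - k) := by
      rw [← pow_add]; congr 1; have := mem_range.1 hk; omega
    rw [h]; ring
  have hsu : ∀ z : ℂ, Summable fun n => ‖u n * z ^ n‖ := by
    intro z
    apply summable_of_ne_finset_zero (s := range (N + 1))
    intro b hb
    rw [hu b (by have := mt mem_range.2 hb; omega)]; simp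
  have hsa : ∀ z : ℂ, ‖z‖ < 1 → Summable fun n => ‖a n * z ^ n‖ := fun z hz =>
    (hf z hz).summable.norm
  apply bessel_le (fun m => (∑ k ∈ range (m + 1), u k * a (m - k)) * (ρ : ℂ) ^ m) (fun j => u j * (ρ : ℂ) ^ j)
  · simp_rw [hpow]
    have h2 := summable_norm_sum_mul_range_of_summable_norm (hsu (ρ : ℂ)) (hsa (ρ : ℂ) hρ)
    exact h2
  · intro w hw
    have hz : ‖(ρ : ℂ) * w‖ < 1 := by rw [norm_mul, hw, mul_one]; exact hρ
    have hPt : ∑' n, u n * ((ρ : ℂ) * w) ^ n = ∑ j ∈ range (N + 1), u j * (ρ : ℂ) ^ j * w ^ j := by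
      rw [tsum_eq_sum (s := range (N + 1))]
      · refine sum_congr rfl fun k hk => ?_
        rw [mul_pow]; ring
      · intro b hb
        rw [hu b (by have := mt mem_range.2 hb; omega)]; simp
    have := hasSum_sum_range_mul_of_summable_norm (hsu ((ρ : ℂ) * w)) (hsa _ hz)
    rw [hPt, (hf _ hz).tsum_eq] at this
    have e : (fun m : ℕ => (∑ k ∈ range (m + 1), u k * a (m - k)) * (ρ : ℂ) ^ m * w ^ m)
        = fun n => ∑ k ∈ range (n + 1), u k * ((ρ : ℂ) * w) ^ k * (a (n - k) * ((ρ : ℂ) * w) ^ (n - k)) := by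
      funext m
      rw [← hpow, mul_pow]; ring
    rw [← e] at this
    rw [this.tsum_eq, norm_mul]
    exact mul_le_of_le_one_right (norm_nonneg _) (hb _ hz)

lemma contr (f : ℂ → ℂ) (a : ℕ → ℂ)
    (hf : ∀ z : ℂ, ‖z‖ < 1 → HasSum (fun n : ℕ => a n * z ^ n) (f z))
    (hb : ∀ z : ℂ, ‖z‖ < 1 → ‖f z‖ ≤ 1) (u : ℕ → ℂ) (N : ℕ) (hu : ∀ j, N < j → u j = 0) :
    ∑ m ∈ range (N + 1), ‖∑ k ∈ range (m + 1), u k * a (m - k)‖ ^ 2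
      ≤ ∑ j ∈ range (N + 1), ‖u j‖ ^ 2 := by
  have key : ∀ d : ℕ → ℂ, Filter.Tendsto (fun ρ : ℝ => ∑ m ∈ range (N + 1), ‖d m * (ρ : ℂ) ^ m‖ ^ 2)
      (nhdsWithin 1 (Set.Iio 1)) (nhds (∑ m ∈ range (N + 1), ‖d m‖ ^ 2)) := by
    intro d
    have hc : Continuous (fun ρ : ℝ => ∑ m ∈ range (N + 1), ‖d m * (ρ : ℂ) ^ m‖ ^ 2) := by fun_prop
    have := (hc.tendsto 1).mono_left (nhdsWithin_le_nhds (s := Set.Iio 1))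
    simpa using this
  refine le_of_tendsto_of_tendsto (key _) (key _) ?_
  filter_upwards [Ioo_mem_nhdsLT (zero_lt_one (α := ℝ))] with ρ hρ
  exact contr_rho f a hf hb u N hu ρ hρ.1.le hρ.2

lemma even_bound (f : ℂ → ℂ) (a : ℕ → ℂ)
    (hf : ∀ z : ℂ, ‖z‖ < 1 → HasSum (fun n : ℕ => a n * z ^ n) (f z))
    (hb : ∀ z : ℂ, ‖z‖ < 1 → ‖f z‖ ≤ 1) (q : ℕ) :
    ‖a (2 * q + 2)‖ ≤ 1 - (∑ j ∈ range (q + 1), ‖a j‖ ^ 2) - ‖a (q + 1)‖ ^ 2 / (1 + ‖a 0‖) := by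
  apply even_alg
  · rw [sum_range_succ']
    have : 0 ≤ ∑ k ∈ range q, ‖a (k + 1)‖ ^ 2 := by positivity
    linarith
  intro β T
  let u : ℕ → ℂ := fun j => if j = 0 then 1 else if j = q + 1 then β else
    if q + 1 < j ∧ j ≤ 2 * q + 2 then T * (starRingEnd ℂ) (a (2 * q + 2 - j)) else 0
  have hu0 : u 0 = 1 := by simp [u]
  have hun : u (q + 1) = β := by simp [u]
  have hus : ∀ k, k < q → u (k + 1) = 0 := by
    intro k hk
    have h1 : k ≠ q := by omega
    have h2 : ¬ (q + 1 < k + 1) := by omega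
    simp [u, h1, h2]
  have hub : ∀ k, k < q + 1 → u (q + 2 + k) = T * (starRingEnd ℂ) (a (q - k)) := by
    intro k hk
    have h1 : ¬ (q + 2 + k = 0) := by omega
    have h2 : ¬ (q + 2 + k = q + 1) := by omega
    have h3 : q + 1 < q + 2 + k ∧ q + 2 + k ≤ 2 * q + 2 := by omega
    have h4 : 2 * q + 2 - (q + 2 + k) = q - k := by omega
    simp only [u, if_neg h1, if_neg h2, if_pos h3, h4]
  have hc := contr f a hf hb u (2 * q + 2) (by
    intro j hj
    have h1 : j ≠ 0 := by omega
    have h2 : j ≠ q + 1 := by omega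
    have h3 : ¬ (j ≤ 2 * q + 2) := by omega
    simp [u, h1, h2, h3])
  have small : ∀ g : ℕ → ℂ, ∀ m, m ≤ q → ∑ k ∈ range (m + 1), u k * g k = g 0 := by
    intro g m hm
    rw [sum_range_succ', hu0, one_mul, sum_eq_zero, zero_add]
    intro k hk
    rw [hus k (by have := mem_range.1 hk; omega), zero_mul]
  have rown : ∀ g : ℕ → ℂ, ∑ k ∈ range (q + 1 + 1), u k * g k = g 0 + β * g (q + 1) := by
    intro g
    rw [sum_range_succ, small g q le_rfl, hun]
  have hsplit : 2 * q + 2 + 1 = (q + 2) + (q + 1) := by ring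
  have rowN : ∑ k ∈ range (2 * q + 2 + 1), u k * a (2 * q + 2 - k)
      = a (2 * q + 2) + β * a (q + 1) + T * ((∑ j ∈ range (q + 1), ‖a j‖ ^ 2 : ℝ) : ℂ) := by
    rw [hsplit, sum_range_add, rown (fun k => a (2 * q + 2 - k))]
    have h1 : 2 * q + 2 - (q + 1) = q + 1 := by omega
    simp only [h1, Nat.sub_zero]
    congr 1
    rw [← sum_range_reflect (fun j => ‖a j‖ ^ 2)]
    push_cast
    rw [mul_sum]
    refine sum_congr rfl fun k hk => ?_
    have hk := mem_range.1 hk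
    have h5 : 2 * q + 2 - (q + 2 + k) = q - k := by omega
    have h6 : q + 1 - 1 - k = q - k := by omega
    rw [hub k hk, h5, mul_assoc, Complex.conj_mul']
  have normu : ∑ j ∈ range (2 * q + 2 + 1), ‖u j‖ ^ 2
      = 1 + ‖β‖ ^ 2 + ‖T‖ ^ 2 * ∑ j ∈ range (q + 1), ‖a j‖ ^ 2 := by
    rw [hsplit, sum_range_add, sum_range_succ, hun, sum_range_succ', hu0, sum_eq_zero]
    · rw [← sum_range_reflect (fun j => ‖a j‖ ^ 2), mul_sum]
      simp only [norm_one, one_pow, zero_add]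
      congr 1
      refine sum_congr rfl fun k hk => ?_
      have hk := mem_range.1 hk
      have h6 : q + 1 - 1 - k = q - k := by omega
      rw [hub k hk, h6, norm_mul, RCLike.norm_conj, mul_pow]
    · intro k hk
      rw [hus k (mem_range.1 hk)]; simp
  rw [normu] at hc
  refine le_trans ?_ hc
  rw [sum_range_succ _ (2 * q + 2), rowN]
  gcongr
  rw [show 2 * q + 2 = (q + 2) + q by ring, sum_range_add _ (q + 2) q, sum_range_succ _ (q + 1), rown (fun k => a (q + 1 - k))]
  have : ∑ x ∈ range (q + 1), ‖∑ k ∈ range (x + 1), u k * a (x - k)‖ ^ 2 = ∑ x ∈ range (q + 1), ‖a x‖ ^ 2 := by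
    refine sum_congr rfl fun m hm => ?_
    have hm := mem_range.1 hm
    rw [small (fun k => a (m - k)) m (by omega)]; simp
  rw [this]
  simp only [Nat.sub_zero, Nat.sub_self]
  have h7 : 0 ≤ ∑ x ∈ range q, ‖∑ k ∈ range (q + 2 + x + 1), u k * a (q + 2 + x - k)‖ ^ 2 := by positivity
  linarith

lemma odd_bound (f : ℂ → ℂ) (a : ℕ → ℂ)
    (hf : ∀ z : ℂ, ‖z‖ < 1 → HasSum (fun n : ℕ => a n * z ^ n) (f z))
    (hb : ∀ z : ℂ, ‖z‖ < 1 → ‖f z‖ ≤ 1) (q : ℕ) :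
    ‖a (2 * q + 1)‖ ≤ 1 - (∑ j ∈ range (q + 1), ‖a j‖ ^ 2) := by
  let b : ℕ → ℂ := fun n => Nat.casesOn n 0 a
  have h := even_bound (fun z => z * f z) b (by
    intro z hz
    rw [← hasSum_nat_add_iff' 1]
    have h := (hf z hz).mul_left z
    have e1 : (fun n => b (n + 1) * z ^ (n + 1)) = fun i => z * (a i * z ^ i) := by
      funext n
      simp only [b]; ring
    have e2 : z * f z - ∑ i ∈ range 1, b i * z ^ i = z * f z := by simp [b]
    rw [e1, e2]
    exact h) (by
    intro z hz
    rw [norm_mul]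
    exact mul_le_one₀ hz.le (norm_nonneg _) (hb z hz)) q
  have e1 : b (2 * q + 2) = a (2 * q + 1) := rfl
  have e2 : b (q + 1) = a q := rfl
  have e3 : ∑ j ∈ range (q + 1), ‖b j‖ ^ 2 = ∑ j ∈ range q, ‖a j‖ ^ 2 := by
    rw [sum_range_succ']; simp [b]
  have e4 : b 0 = 0 := rfl
  rw [e1, e2, e3, e4] at h
  rw [sum_range_succ]
  simp at h
  linarith

theorem stmt_13 (f : ℂ → ℂ) (a : ℕ → ℂ)
    (hf : ∀ z : ℂ, ‖z‖ < 1 → HasSum (fun n : ℕ => a n * z ^ n) (f z))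
    (hb : ∀ z : ℂ, ‖z‖ < 1 → ‖f z‖ ≤ 1)
    (r : ℝ) (hr : r ∈ Set.Ico (0:ℝ) 1) :
    (∑' n : ℕ, ‖a (n + 1)‖ * r ^ (n + 1)) +
      (1 / (1 + ‖a 0‖) + r / (1 - r)) *
        ∑' n : ℕ, ‖a (n + 1)‖ ^ 2 * r ^ (2 * (n + 1)) ≤
    (1 - ‖a 0‖ ^ 2) * r / (1 - r) := by
  obtain ⟨hr0, hr1⟩ := hr
  have hr1' : 0 < 1 - r := by linarith
  have hs1 : Summable fun n : ℕ => ‖a (n + 1)‖ * r ^ (n + 1) := by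
    have hz : ‖(r : ℂ)‖ < 1 := by rw [Complex.norm_real, Real.norm_of_nonneg hr0]; exact hr1
    have := (hf r hz).summable.norm
    have h2 := (summable_nat_add_iff 1).2 this
    simpa [abs_of_nonneg hr0] using h2
  have hs2 : Summable fun n : ℕ => ‖a (n + 1)‖ ^ 2 * r ^ (2 * (n + 1)) := by
    refine Summable.of_nonneg_of_le (fun n => by positivity) (fun n => ?_)
      (hs1.mul_left (∑' n : ℕ, ‖a (n + 1)‖ * r ^ (n + 1)))
    have h3 : ‖a (n + 1)‖ * r ^ (n + 1) ≤ ∑' n : ℕ, ‖a (n + 1)‖ * r ^ (n + 1) :=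
      hs1.le_tsum n (fun j _ => by positivity)
    calc ‖a (n + 1)‖ ^ 2 * r ^ (2 * (n + 1)) = (‖a (n + 1)‖ * r ^ (n + 1)) * (‖a (n + 1)‖ * r ^ (n + 1)) := by ring
      _ ≤ _ := mul_le_mul_of_nonneg_right h3 (by positivity)
  have key : ∀ M : ℕ, (∑ n ∈ range (2 * M), ‖a (n + 1)‖ * r ^ (n + 1)) +
      (1 / (1 + ‖a 0‖) + r / (1 - r)) * (∑ n ∈ range M, ‖a (n + 1)‖ ^ 2 * r ^ (2 * (n + 1)))
      + r ^ (2 * M + 1) / (1 - r) * (1 - ∑ j ∈ range (M + 1), ‖a j‖ ^ 2)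
      ≤ (1 - ‖a 0‖ ^ 2) * r / (1 - r) := by
    intro M
    induction M with
    | zero => simp; apply le_of_eq; ring
    | succ M ih =>
      refine le_trans ?_ ih
      have ho := mul_le_mul_of_nonneg_right (odd_bound f a hf hb M) (pow_nonneg hr0 (2 * M + 1))
      have he := mul_le_mul_of_nonneg_right (even_bound f a hf hb M) (pow_nonneg hr0 (2 * M + 2))
      rw [show 2 * (M + 1) = 2 * M + 1 + 1 by ring, sum_range_succ _ (2 * M + 1), sum_range_succ _ (2 * M),
        sum_range_succ _ M, sum_range_succ _ (M + 1)]
      set D := 1 - ∑ j ∈ range (M + 1), ‖a j‖ ^ 2 with hD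
      have e1 : 1 - (∑ j ∈ range (M + 1), ‖a j‖ ^ 2 + ‖a (M + 1)‖ ^ 2) = D - ‖a (M + 1)‖ ^ 2 := by
        rw [hD]; ring
      rw [e1]
      have e2 : D * r ^ (2 * M + 1) + (D - ‖a (M + 1)‖ ^ 2 / (1 + ‖a 0‖)) * r ^ (2 * M + 2)
          + (1 / (1 + ‖a 0‖) + r / (1 - r)) * (‖a (M + 1)‖ ^ 2 * r ^ (2 * (M + 1)))
          + r ^ (2 * M + 1 + 1 + 1) / (1 - r) * (D - ‖a (M + 1)‖ ^ 2) = r ^ (2 * M + 1) / (1 - r) * D := by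
        have : 0 < 1 + ‖a 0‖ := by positivity
        have h9 : (1 - r) ≠ 0 := hr1'.ne'
        field_simp
        ring
      rw [show 2 * M + 1 + 1 = 2 * M + 2 by ring] at *
      linarith
  have t1 := hs1.hasSum.tendsto_sum_nat.comp (Filter.tendsto_id.const_mul_atTop' (r := 2) two_pos)
  have t2 := hs2.hasSum.tendsto_sum_nat
  refine le_of_tendsto' (t1.add (t2.const_mul _)) (fun M => le_trans ?_ (key M))
  have : 0 ≤ r ^ (2 * M + 1) / (1 - r) * (1 - ∑ j ∈ range (M + 1), ‖a j‖ ^ 2) := by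
    have h8 := (norm_nonneg _).trans (odd_bound f a hf hb M)
    positivity
  simp only [Function.comp, id]
  linarith
end

section
/- Let k ≥ 1 and 0 ≤ m ≤ k be integers, and suppose f(z) = ∑_{s=0}^∞ c_s z^{sk+m} is holomorphic on the unit disk with |f(z)| ≤ 1 for all |z| < 1. Then for all r ∈ [0,1) satisfying (1 − |c₀| − |c₀|²)·r^{m+k} + r^k + |c₀|·r^m − 1 ≤ 0: ∑_{s=0}^∞ |c_s| r^{sk+m} + (1/(r^m + |c₀| r^m) + r^{k−m}/(1 − r^k))·∑_{s=1}^∞ |c_s|² r^{2sk+2m} ≤ 1. -/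
/-- finite summation -/
lemma aux_partial (b : ℕ → ℝ) (q : ℝ) (hq0 : 0 ≤ q) (hq1 : q < 1) (hb : ∀ s, 0 ≤ b s)
    (hO : ∀ n, b (2*n+1) ≤ 1 - ∑ j ∈ Finset.range (n+1), b j ^ 2)
    (hE : ∀ n, b (2*n+2) ≤ 1 - ∑ j ∈ Finset.range (n+1), b j ^ 2 - b (n+1)^2/(1 + b 0)) (n : ℕ) :
    ∑ s ∈ Finset.range (2*n), b (s+1) * q^(s+1) +
      (1/(1+b 0) + q/(1-q)) * ∑ s ∈ Finset.range n, b (s+1)^2 * q^(2*(s+1))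
      ≤ (1 - b 0^2) * (q - q^(2*n+1))/(1-q) + (∑ j ∈ Finset.range n, b (j+1)^2) * q^(2*n+1)/(1-q) := by
  have h1 : 0 < 1 - q := by linarith
  induction n with
  | zero => simp
  | succ n ih =>
    have e1 := hO n
    have e2 := hE n
    rw [Finset.sum_range_succ'] at e1 e2
    rw [show 2*(n+1) = 2*n+1+1 by ring, Finset.sum_range_succ, Finset.sum_range_succ,
      Finset.sum_range_succ (fun s => b (s+1)^2 * q^(2*(s+1))),
      Finset.sum_range_succ (fun s => b (s+1)^2)]
    set Q := ∑ j ∈ Finset.range n, b (j+1)^2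
    have m1 := mul_le_mul_of_nonneg_right e1 (pow_nonneg hq0 (2*n+1))
    have m2 := mul_le_mul_of_nonneg_right e2 (pow_nonneg hq0 (2*n+2))
    have key : (1 - b 0^2) * (q - q^(2*n+1+1+1))/(1-q) + (Q + b (n+1)^2) * q^(2*n+1+1+1)/(1-q)
       = (1 - b 0^2) * (q - q^(2*n+1))/(1-q) + Q * q^(2*n+1)/(1-q)
        + ((1 - b 0^2 - Q) * (q^(2*n+1) + q^(2*n+2)) + q/(1-q) * b (n+1)^2 * q^(2*n+2)) := by
      field_simp
      ring
    rw [key]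
    have k2 : q^(2*(n+1)) = q^(2*n+2) := by ring
    rw [k2]
    have k3 : q^(2*n+1+1) = q^(2*n+2) := by ring
    rw [k3, show 2*n+1+1 = 2*n+2 by ring]
    have k4 : b (n+1)^2/(1 + b 0) = 1/(1+b 0) * b (n+1)^2 := by ring
    rw [k4] at m2
    linarith

lemma aux_final (b : ℕ → ℝ) (q : ℝ) (hq0 : 0 ≤ q) (hq1 : q < 1) (hb : ∀ s, 0 ≤ b s)
    (hO : ∀ n, b (2*n+1) ≤ 1 - ∑ j ∈ Finset.range (n+1), b j ^ 2)
    (hE : ∀ n, b (2*n+2) ≤ 1 - ∑ j ∈ Finset.range (n+1), b j ^ 2 - b (n+1)^2/(1 + b 0))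
    (hS : Summable fun s => b (s+1) * q^(s+1)) (hS2 : Summable fun s => b (s+1)^2 * q^(2*(s+1))) :
    ∑' s, b (s+1) * q^(s+1) +
      (1/(1+b 0) + q/(1-q)) * ∑' s, b (s+1)^2 * q^(2*(s+1)) ≤ (1 - b 0^2) * q/(1-q) := by
  have h1 : 0 < 1 - q := by linarith
  have t1 := hS.hasSum.tendsto_sum_nat.comp
    (Filter.tendsto_id.const_mul_atTop' (show 0 < 2 by norm_num) : Filter.Tendsto (fun n : ℕ => 2 * n) _ _)
  have t2 := hS2.hasSum.tendsto_sum_nat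
  refine le_of_tendsto' (t1.add (t2.const_mul (1/(1+b 0) + q/(1-q)))) fun n => ?_
  refine (aux_partial b q hq0 hq1 hb hO hE n).trans ?_
  have := hO n
  rw [Finset.sum_range_succ'] at this
  have hb' := hb (2*n+1)
  rw [← add_div]
  gcongr
  have : (∑ j ∈ Finset.range n, b (j+1)^2) * q^(2*n+1) ≤ (1 - b 0^2) * q^(2*n+1) := by
    gcongr; linarith
  linarith
open Complex ComplexConjugate in
noncomputable def Eexp (n : ℤ) (θ : ℝ) : ℂ := Complex.exp ((n * Complex.I) * θ)

lemma Eexp_add (m n : ℤ) (θ : ℝ) : Eexp (m + n) θ = Eexp m θ * Eexp n θ := by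
  unfold Eexp; rw [← Complex.exp_add]; push_cast; ring_nf

lemma Eexp_zero (θ : ℝ) : Eexp 0 θ = 1 := by simp [Eexp]

lemma Eexp_norm (n : ℤ) (θ : ℝ) : ‖Eexp n θ‖ = 1 := by
  unfold Eexp
  rw [show ((n:ℂ) * Complex.I) * θ = ((n * θ : ℝ) : ℂ) * Complex.I by push_cast; ring]
  exact Complex.norm_exp_ofReal_mul_I _

lemma Eexp_conj (n : ℤ) (θ : ℝ) : (starRingEnd ℂ) (Eexp n θ) = Eexp (-n) θ := by
  unfold Eexp
  rw [← Complex.exp_conj]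
  simp

@[fun_prop]
lemma Eexp_cont (n : ℤ) : Continuous (Eexp n) := by
  unfold Eexp; fun_prop

lemma Eexp_int (n : ℤ) : ∫ θ in (0:ℝ)..(2*Real.pi), Eexp n θ = if n = 0 then 2 * (Real.pi : ℂ) else 0 := by
  split_ifs with h
  · subst h; simp [Eexp_zero]
  · unfold Eexp
    rw [integral_exp_mul_complex (by simp [h])]
    have : (n * Complex.I) * ((2 * Real.pi : ℝ) : ℂ) = n * (2 * Real.pi * Complex.I) := by
      push_cast; ring
    rw [this, Complex.exp_int_mul_two_pi_mul_I]
    simp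

lemma Hint (d : ℕ → ℂ) (hs : Summable fun s => ‖d s‖) (n : ℤ) :
    ∫ θ in (0:ℝ)..(2*Real.pi), (∑' s : ℕ, d s * Eexp s θ) * Eexp n θ
      = if n ≤ 0 then 2 * (Real.pi : ℂ) * d (-n).toNat else 0 := by
  have h := intervalIntegral.hasSum_integral_of_dominated_convergence (a := 0) (b := 2*Real.pi)
    (μ := MeasureTheory.volume)
    (F := fun (s:ℕ) θ => (d s * Eexp s θ) * Eexp n θ)
    (f := fun θ => (∑' s : ℕ, d s * Eexp s θ) * Eexp n θ)
    (fun s _ => ‖d s‖) (fun s => by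
      apply Continuous.aestronglyMeasurable; fun_prop)
    (fun s => by simp [Eexp_norm]) (by simp [hs]) (by simp)
    (by
      refine Filter.Eventually.of_forall fun θ _ => ?_
      apply HasSum.mul_right
      apply Summable.hasSum
      apply Summable.of_norm
      simpa [Eexp_norm] using hs)
  have e : ∀ s : ℕ, ∫ θ in (0:ℝ)..(2*Real.pi), (d s * Eexp s θ) * Eexp n θ
      = d s * (if (s:ℤ) + n = 0 then 2 * (Real.pi : ℂ) else 0) := by
    intro s
    rw [← Eexp_int, ← intervalIntegral.integral_const_mul]
    congr 1; ext θ; rw [Eexp_add]; ring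
  simp only [e] at h
  rw [← h.tsum_eq]
  split_ifs with hn
  · rw [tsum_eq_single (-n).toNat]
    · rw [if_pos (by omega)]; ring
    · intro s hs; rw [if_neg (by omega)]; simp
  · convert tsum_zero with s
    rw [if_neg (by omega)]; simp

lemma core (d : ℕ → ℂ) (hs : Summable fun s => ‖d s‖)
    (hb : ∀ θ : ℝ, ‖∑' s : ℕ, d s * Eexp s θ‖ ≤ 1) (a : ℕ → ℂ) (n N : ℕ) (hN : 2 * n ≤ N) (hN1 : 1 ≤ N) :
    ‖d N + 2 * ∑ j ∈ Finset.range (n+1), a j * d j + (if N = 2 * n then a n ^ 2 * d 0 else 0)‖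
      ≤ 1 + ∑ j ∈ Finset.range (n+1), ‖a j‖^2 := by
  set H : ℝ → ℂ := fun θ => ∑' s : ℕ, d s * Eexp s θ with hH
  have Hc : Continuous H := continuous_tsum (fun s => by fun_prop) hs (fun s θ => by simp [Eexp_norm])
  have HI : ∀ n : ℤ, ∫ θ in (0:ℝ)..(2*Real.pi), H θ * Eexp n θ
      = if n ≤ 0 then 2 * (Real.pi : ℂ) * d (-n).toNat else 0 := Hint d hs
  set p : ℝ → ℂ := fun θ => 1 + ∑ j ∈ Finset.range (n+1), a j * Eexp ((N:ℤ) - j) θ with hp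
  have pc : Continuous p := by fun_prop
  have pi0 := Real.pi_pos
  have I1 : ∫ θ in (0:ℝ)..(2*Real.pi), H θ * (p θ ^ 2 * Eexp (-(N:ℤ)) θ)
      = 2 * (Real.pi:ℂ) * (d N + 2 * ∑ j ∈ Finset.range (n+1), a j * d j + (if N = 2 * n then a n ^ 2 * d 0 else 0)) := by
    have ex : ∀ θ, H θ * (p θ ^ 2 * Eexp (-(N:ℤ)) θ) = H θ * Eexp (-(N:ℤ)) θ
        + ∑ j ∈ Finset.range (n+1), (2 * a j) * (H θ * Eexp (-(j:ℤ)) θ)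
        + ∑ i ∈ Finset.range (n+1), ∑ j ∈ Finset.range (n+1), (a i * a j) * (H θ * Eexp ((N:ℤ) - i - j) θ) := by
      intro θ
      have x1 : ∀ j : ℕ, Eexp (-(j:ℤ)) θ = Eexp ((N:ℤ) - j) θ * Eexp (-(N:ℤ)) θ := by
        intro j; rw [← Eexp_add]; congr 1; ring
      have x2 : ∀ i j : ℕ, Eexp ((N:ℤ) - i - j) θ = Eexp ((N:ℤ) - i) θ * Eexp ((N:ℤ) - j) θ * Eexp (-(N:ℤ)) θ := by
        intro i j; rw [← Eexp_add, ← Eexp_add]; congr 1; ring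
      have y1 : ∑ j ∈ Finset.range (n+1), (2 * a j) * (H θ * Eexp (-(j:ℤ)) θ)
          = 2 * H θ * Eexp (-(N:ℤ)) θ * ∑ j ∈ Finset.range (n+1), a j * Eexp ((N:ℤ) - j) θ := by
        rw [Finset.mul_sum]; refine Finset.sum_congr rfl fun j _ => ?_
        rw [x1]; ring
      have y2 : ∑ i ∈ Finset.range (n+1), ∑ j ∈ Finset.range (n+1), (a i * a j) * (H θ * Eexp ((N:ℤ) - i - j) θ)
          = H θ * Eexp (-(N:ℤ)) θ * ((∑ j ∈ Finset.range (n+1), a j * Eexp ((N:ℤ) - j) θ) * (∑ j ∈ Finset.range (n+1), a j * Eexp ((N:ℤ) - j) θ)) := by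
        rw [Finset.sum_mul_sum, Finset.mul_sum]; refine Finset.sum_congr rfl fun i _ => ?_
        rw [Finset.mul_sum]; refine Finset.sum_congr rfl fun j _ => ?_
        rw [x2]; ring
      rw [y1, y2]; simp only [hp]; ring
    simp only [ex]
    rw [intervalIntegral.integral_add, intervalIntegral.integral_add, intervalIntegral.integral_finsetSum,
      intervalIntegral.integral_finsetSum]
    · have z : ∀ i ∈ Finset.range (n+1), ∫ θ in (0:ℝ)..(2*Real.pi), ∑ j ∈ Finset.range (n+1), (a i * a j) * (H θ * Eexp ((N:ℤ) - i - j) θ)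
         = ∑ j ∈ Finset.range (n+1), if i = n ∧ j = n ∧ N = 2 * n then 2 * (Real.pi:ℂ) * (a n ^ 2 * d 0) else 0 := by
        intro i hi
        rw [intervalIntegral.integral_finsetSum]
        · refine Finset.sum_congr rfl fun j hj => ?_
          rw [Finset.mem_range] at hi hj
          rw [intervalIntegral.integral_const_mul, HI]
          by_cases h : i = n ∧ j = n ∧ N = 2 * n
          · rw [if_pos h, if_pos (by omega), show (-((N:ℤ) - i - j)).toNat = 0 by omega, h.1, h.2.1]; ring
          · rw [if_neg h, if_neg (by omega)]; simp
        · intro j _; apply Continuous.intervalIntegrable; fun_prop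
      rw [Finset.sum_congr rfl z]
      simp only [intervalIntegral.integral_const_mul, HI]
      have w : ∑ i ∈ Finset.range (n+1), ∑ j ∈ Finset.range (n+1), (if i = n ∧ j = n ∧ N = 2 * n then 2 * (Real.pi:ℂ) * (a n ^ 2 * d 0) else 0) = 2 * (Real.pi:ℂ) * (if N = 2 * n then a n ^ 2 * d 0 else 0) := by
        simp only [ite_and]
        simp
      rw [w]
      simp only [Left.neg_nonpos_iff, Int.natCast_nonneg, if_true, neg_neg, Int.toNat_natCast]
      rw [mul_add, mul_add, Finset.mul_sum, Finset.mul_sum]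
      congr 2
      refine Finset.sum_congr rfl fun j _ => ?_
      ring
    all_goals (intros; apply Continuous.intervalIntegrable; fun_prop)
  have I2 : ((∫ θ in (0:ℝ)..(2*Real.pi), ‖p θ‖ ^ 2 : ℝ) : ℂ)
      = 2 * (Real.pi:ℂ) * (1 + ∑ j ∈ Finset.range (n+1), (‖a j‖:ℂ)^2) := by
    rw [← intervalIntegral.integral_ofReal]
    have ex : ∀ θ, ((‖p θ‖ ^ 2 : ℝ) : ℂ) = Eexp 0 θ
        + ∑ j ∈ Finset.range (n+1), a j * Eexp ((N:ℤ) - j) θ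
        + ∑ j ∈ Finset.range (n+1), (starRingEnd ℂ) (a j) * Eexp ((j:ℤ) - N) θ
        + ∑ i ∈ Finset.range (n+1), ∑ j ∈ Finset.range (n+1), (a i * (starRingEnd ℂ) (a j)) * Eexp ((j:ℤ) - i) θ := by
      intro θ
      push_cast
      rw [← Complex.mul_conj']
      have x0 : (starRingEnd ℂ) (p θ) = 1 + ∑ j ∈ Finset.range (n+1), (starRingEnd ℂ) (a j) * Eexp ((j:ℤ) - N) θ := by
        simp [hp, Eexp_conj]
      have x2 : ∑ i ∈ Finset.range (n+1), ∑ j ∈ Finset.range (n+1), (a i * (starRingEnd ℂ) (a j)) * Eexp ((j:ℤ) - i) θ = (∑ j ∈ Finset.range (n+1), a j * Eexp ((N:ℤ) - j) θ) * ∑ j ∈ Finset.range (n+1), (starRingEnd ℂ) (a j) * Eexp ((j:ℤ) - N) θ := by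
        rw [Finset.sum_mul_sum]; refine Finset.sum_congr rfl fun i _ => Finset.sum_congr rfl fun j _ => ?_
        rw [show (j:ℤ) - i = ((N:ℤ) - i) + (j - N) by ring, Eexp_add]; ring
      rw [x0, x2, Eexp_zero]; simp only [hp]; ring
    simp only [ex]
    rw [intervalIntegral.integral_add, intervalIntegral.integral_add, intervalIntegral.integral_add, intervalIntegral.integral_finsetSum,
      intervalIntegral.integral_finsetSum, intervalIntegral.integral_finsetSum]
    · have z : ∀ i ∈ Finset.range (n+1), ∫ θ in (0:ℝ)..(2*Real.pi), ∑ j ∈ Finset.range (n+1), (a i * (starRingEnd ℂ) (a j)) * Eexp ((j:ℤ) - i) θ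
         = 2 * (Real.pi:ℂ) * (‖a i‖:ℂ)^2 := by
        intro i hi
        rw [intervalIntegral.integral_finsetSum]
        · simp only [intervalIntegral.integral_const_mul, Eexp_int]
          rw [Finset.sum_eq_single_of_mem i hi]
          · simp [Complex.mul_conj']; ring
          · intro j _ hj; rw [if_neg (by omega)]; simp
        · intro j _; apply Continuous.intervalIntegrable; fun_prop
      rw [Finset.sum_congr rfl z]
      simp only [intervalIntegral.integral_const_mul, Eexp_int]
      rw [Finset.sum_eq_zero (s := Finset.range (n+1)), Finset.sum_eq_zero (s := Finset.range (n+1)), if_pos trivial, mul_add, Finset.mul_sum]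
      · ring
      · intro j hj; rw [Finset.mem_range] at hj; rw [if_neg (by omega)]; simp
      · intro j hj; rw [Finset.mem_range] at hj; rw [if_neg (by omega)]; simp
    all_goals (intros; apply Continuous.intervalIntegrable; fun_prop)
  have I3 : ∫ θ in (0:ℝ)..(2*Real.pi), ‖p θ‖ ^ 2 = 2 * Real.pi * (1 + ∑ j ∈ Finset.range (n+1), ‖a j‖^2) := by
    apply Complex.ofReal_injective; rw [I2]; push_cast; rfl
  have I4 : ‖∫ θ in (0:ℝ)..(2*Real.pi), H θ * (p θ ^ 2 * Eexp (-(N:ℤ)) θ)‖ ≤ ∫ θ in (0:ℝ)..(2*Real.pi), ‖p θ‖ ^ 2 := by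
    apply intervalIntegral.norm_integral_le_of_norm_le (by positivity)
    · refine Filter.Eventually.of_forall fun θ _ => ?_
      simp only [norm_mul, norm_pow, Eexp_norm, mul_one]
      exact mul_le_of_le_one_left (by positivity) (hb θ)
    · apply Continuous.intervalIntegrable; fun_prop
  rw [I1, I3, norm_mul, show ‖2 * (Real.pi:ℂ)‖ = 2 * Real.pi by simp [abs_of_pos pi0]] at I4
  exact le_of_mul_le_mul_left I4 (by positivity)

lemma exists_phase (z : ℂ) : ∃ φ : ℂ, ‖φ‖ = 1 ∧ z = φ * ‖z‖ := by
  by_cases h : z = 0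
  · exact ⟨1, by simp, by simp [h]⟩
  · have : (‖z‖:ℂ) ≠ 0 := by simpa using h
    exact ⟨z / ‖z‖, by simp [h], by field_simp⟩

lemma carlson_odd (d : ℕ → ℂ) (hs : Summable fun s => ‖d s‖)
    (hb : ∀ θ : ℝ, ‖∑' s : ℕ, d s * Eexp s θ‖ ≤ 1) (n : ℕ) :
    ‖d (2*n+1)‖ ≤ 1 - ∑ j ∈ Finset.range (n+1), ‖d j‖ ^ 2 := by
  obtain ⟨φ, h1, h2⟩ := exists_phase (d (2*n+1))
  have h := core d hs hb (fun j => φ * (starRingEnd ℂ) (d j)) n (2*n+1) (by omega) (by omega)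
  rw [if_neg (by omega)] at h
  have e : d (2*n+1) + 2 * ∑ j ∈ Finset.range (n+1), φ * (starRingEnd ℂ) (d j) * d j + 0
      = φ * ((‖d (2*n+1)‖ + 2 * ∑ j ∈ Finset.range (n+1), ‖d j‖ ^ 2 : ℝ) : ℂ) := by
    push_cast
    simp only [mul_assoc, Complex.conj_mul']
    rw [← Finset.mul_sum]
    nth_rewrite 1 [h2]; ring
  rw [e, norm_mul, h1, one_mul, Complex.norm_real, Real.norm_of_nonneg (by positivity)] at h
  simp only [norm_mul, h1, one_mul, RCLike.norm_conj] at h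
  linarith

lemma carlson_even (d : ℕ → ℂ) (hs : Summable fun s => ‖d s‖)
    (hb : ∀ θ : ℝ, ‖∑' s : ℕ, d s * Eexp s θ‖ ≤ 1) (n : ℕ) :
    ‖d (2*n+2)‖ ≤ 1 - ∑ j ∈ Finset.range (n+1), ‖d j‖ ^ 2 - ‖d (n+1)‖^2/(1+‖d 0‖) := by
  obtain ⟨φ, h1, h2⟩ := exists_phase (d (2*n+2))
  set τ : ℝ := 1/(1+‖d 0‖) with hτ
  have h := core d hs hb (fun j => if j = n+1 then φ * τ * (starRingEnd ℂ) (d j) else φ * (starRingEnd ℂ) (d j)) (n+1) (2*n+2) (by omega) (by omega)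
  rw [if_pos (by omega), Finset.sum_range_succ, Finset.sum_range_succ _ (n+1)] at h
  simp only [if_true] at h
  have s1 : ∑ j ∈ Finset.range (n+1), (if j = n+1 then φ * τ * (starRingEnd ℂ) (d j) else φ * (starRingEnd ℂ) (d j)) * d j = φ * ∑ j ∈ Finset.range (n+1), (‖d j‖:ℂ) ^ 2 := by
    rw [Finset.mul_sum]; refine Finset.sum_congr rfl fun j hj => ?_
    rw [Finset.mem_range] at hj
    rw [if_neg (by omega), mul_assoc, Complex.conj_mul']
  have s2 : ∑ j ∈ Finset.range (n+1), ‖(if j = n+1 then φ * τ * (starRingEnd ℂ) (d j) else φ * (starRingEnd ℂ) (d j))‖^2 = ∑ j ∈ Finset.range (n+1), ‖d j‖ ^ 2 := by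
    refine Finset.sum_congr rfl fun j hj => ?_
    rw [Finset.mem_range] at hj
    rw [if_neg (by omega)]; simp [h1]
  rw [s1, s2] at h
  have t0 : 0 ≤ τ := by positivity
  have e : d (2*n+2) + 2 * (φ * ∑ j ∈ Finset.range (n+1), (‖d j‖:ℂ) ^ 2 + φ * τ * (starRingEnd ℂ) (d (n+1)) * d (n+1))
      = φ * ((‖d (2*n+2)‖ + 2 * (∑ j ∈ Finset.range (n+1), ‖d j‖ ^ 2 + τ * ‖d (n+1)‖^2) : ℝ) : ℂ) := by
    push_cast
    simp only [mul_assoc, Complex.conj_mul']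
    nth_rewrite 1 [h2]; ring
  rw [e] at h
  have tri := norm_sub_le_norm_add (φ * ((‖d (2*n+2)‖ + 2 * (∑ j ∈ Finset.range (n+1), ‖d j‖ ^ 2 + τ * ‖d (n+1)‖^2) : ℝ) : ℂ)) ((φ * τ * (starRingEnd ℂ) (d (n+1)))^2 * d 0)
  rw [norm_mul φ, h1, one_mul, Complex.norm_real, Real.norm_of_nonneg (by positivity)] at tri
  simp only [norm_mul, norm_pow, h1, one_mul, RCLike.norm_conj, Complex.norm_real, Real.norm_of_nonneg t0] at tri h
  have tt : τ * (1 + ‖d 0‖) = 1 := by rw [hτ]; field_simp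
  have : ‖d (n+1)‖^2/(1+‖d 0‖) = τ * ‖d (n+1)‖^2 := by rw [hτ]; ring
  rw [this]
  have k : (τ * ‖d (n+1)‖)^2 * ‖d 0‖ + (τ * ‖d (n+1)‖)^2 = τ * ‖d (n+1)‖^2 := by
    calc _ = (τ * (1 + ‖d 0‖)) * (τ * ‖d (n+1)‖^2) := by ring
      _ = _ := by rw [tt, one_mul]
  linarith

lemma d_props (k m : ℕ) (hk : 1 ≤ k) (f : ℂ → ℂ) (c : ℕ → ℂ)
    (hf : ∀ z : ℂ, ‖z‖ < 1 → HasSum (fun s : ℕ => c s * z ^ (s * k + m)) (f z))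
    (hb : ∀ z : ℂ, ‖z‖ < 1 → ‖f z‖ ≤ 1) (t : ℝ) (ht : t ∈ Set.Ioo (0:ℝ) 1) :
    (Summable fun s => ‖c s * (t:ℂ) ^ (s * k + m)‖) ∧
    ∀ θ : ℝ, ‖∑' s : ℕ, (c s * (t:ℂ) ^ (s * k + m)) * Eexp s θ‖ ≤ 1 := by
  have hn : ‖(t:ℂ)‖ < 1 := by rw [Complex.norm_real, Real.norm_of_nonneg ht.1.le]; exact ht.2
  refine ⟨(hf t hn).summable.norm, fun θ => ?_⟩
  set ω := Eexp 1 (θ / k) with hω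
  have w1 : ‖ω‖ = 1 := Eexp_norm _ _
  have hz : ‖(t:ℂ) * ω‖ < 1 := by rw [norm_mul, w1, mul_one]; exact hn
  have wk : ∀ s : ℕ, ω ^ (s * k) = Eexp s θ := by
    intro s
    have : (k:ℂ) ≠ 0 := by exact_mod_cast (by omega : k ≠ 0)
    rw [hω]; unfold Eexp
    rw [← Complex.exp_nat_mul]; congr 1; push_cast; field_simp
  have h := hf _ hz
  have e : (fun s : ℕ => c s * ((t:ℂ) * ω) ^ (s * k + m)) = fun s => ((c s * (t:ℂ) ^ (s * k + m)) * Eexp s θ) * ω ^ m := by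
    ext s; rw [mul_pow, pow_add ω, wk]; ring
  rw [e] at h
  have h2 := h.tsum_eq
  rw [tsum_mul_right] at h2
  have h3 := hb _ hz
  rw [← h2, norm_mul, norm_pow, w1, one_pow, mul_one] at h3
  exact h3

theorem stmt_14 (k m : ℕ) (hk : 1 ≤ k) (hm : m ≤ k) (f : ℂ → ℂ) (c : ℕ → ℂ)
    (hf : ∀ z : ℂ, ‖z‖ < 1 → HasSum (fun s : ℕ => c s * z ^ (s * k + m)) (f z))
    (hb : ∀ z : ℂ, ‖z‖ < 1 → ‖f z‖ ≤ 1)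
    (r : ℝ) (hr : r ∈ Set.Ico (0:ℝ) 1)
    (hroot : (1 - ‖c 0‖ - ‖c 0‖ ^ 2) * r ^ (m + k) + r ^ k + ‖c 0‖ * r ^ m - 1 ≤ 0) :
    (∑' s : ℕ, ‖c s‖ * r ^ (s * k + m)) +
      (1 / (r ^ m + ‖c 0‖ * r ^ m) + r ^ (k - m) / (1 - r ^ k)) *
        ∑' s : ℕ, ‖c (s + 1)‖ ^ 2 * r ^ (2 * (s + 1) * k + 2 * m) ≤ 1 := by
  obtain ⟨hr0, hr1⟩ := hr
  have nn : ∀ (t : ℝ), t ∈ Set.Ioo (0:ℝ) 1 → ∀ s, ‖c s * (t:ℂ) ^ (s * k + m)‖ = ‖c s‖ * t ^ (s * k + m) := by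
    intro t ht s
    rw [norm_mul, norm_pow, Complex.norm_real, Real.norm_of_nonneg ht.1.le]
  have ev : ∀ᶠ t : ℝ in nhdsWithin 1 (Set.Iio 1), t ∈ Set.Ioo (0:ℝ) 1 :=
    Ioo_mem_nhdsLT (by norm_num)
  have lim : ∀ F : ℝ → ℝ, ContinuousAt F 1 → (∀ t ∈ Set.Ioo (0:ℝ) 1, F t ≤ 0) → F 1 ≤ 0 := by
    intro F hF h
    exact le_of_tendsto (hF.tendsto.mono_left nhdsWithin_le_nhds) (ev.mono h)
  have hO : ∀ n, ‖c (2*n+1)‖ ≤ 1 - ∑ j ∈ Finset.range (n+1), ‖c j‖ ^ 2 := by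
    intro n
    have := lim (fun t => ‖c (2*n+1)‖ * t ^ ((2*n+1) * k + m) - (1 - ∑ j ∈ Finset.range (n+1), (‖c j‖ * t ^ (j * k + m)) ^ 2))
      (by fun_prop) (fun t ht => by
        obtain ⟨h1, h2⟩ := d_props k m hk f c hf hb t ht
        have := carlson_odd _ h1 h2 n
        simp only [nn t ht] at this
        linarith)
    simp only [one_pow, mul_one] at this
    linarith
  have hE : ∀ n, ‖c (2*n+2)‖ ≤ 1 - ∑ j ∈ Finset.range (n+1), ‖c j‖ ^ 2 - ‖c (n+1)‖^2/(1+‖c 0‖) := by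
    intro n
    have := lim (fun t => ‖c (2*n+2)‖ * t ^ ((2*n+2) * k + m) - (1 - ∑ j ∈ Finset.range (n+1), (‖c j‖ * t ^ (j * k + m)) ^ 2 - (‖c (n+1)‖ * t ^ ((n+1) * k + m))^2/(1+‖c 0‖ * t ^ (0 * k + m))))
      (by
        have : 1 + ‖c 0‖ * (1:ℝ) ^ (0 * k + m) ≠ 0 := by positivity
        fun_prop (disch := assumption)) (fun t ht => by
        obtain ⟨h1, h2⟩ := d_props k m hk f c hf hb t ht
        have := carlson_even _ h1 h2 n
        simp only [nn t ht] at this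
        linarith)
    simp only [one_pow, mul_one] at this
    linarith
  set q := r ^ k with hq
  have hq0 : 0 ≤ q := by positivity
  have hq1 : q < 1 := pow_lt_one₀ hr0 hr1 (by omega)
  have h1 : 0 < 1 - q := by linarith
  have b1 : ∀ s, ‖c (s+1)‖ ≤ 1 := by
    intro s
    obtain ⟨n, rfl | rfl⟩ := Nat.even_or_odd' s
    · have := hO n
      have : 0 ≤ ∑ j ∈ Finset.range (n+1), ‖c j‖ ^ 2 := by positivity
      linarith
    · have := hE n
      have : 0 ≤ ∑ j ∈ Finset.range (n+1), ‖c j‖ ^ 2 := by positivity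
      have : 0 ≤ ‖c (n+1)‖^2/(1+‖c 0‖) := by positivity
      linarith
  have hS : Summable fun s => ‖c (s+1)‖ * q^(s+1) := by
    refine Summable.of_nonneg_of_le (fun s => by positivity) (fun s => ?_)
      ((summable_nat_add_iff 1).2 (summable_geometric_of_lt_one hq0 hq1))
    exact mul_le_of_le_one_left (by positivity) (b1 s)
  have hS2 : Summable fun s => ‖c (s+1)‖^2 * q^(2*(s+1)) := by
    refine Summable.of_nonneg_of_le (fun s => by positivity) (fun s => ?_) hS
    have : ‖c (s+1)‖ * q^(s+1) ≤ 1 := mul_le_one₀ (b1 s) (by positivity) (pow_le_one₀ hq0 hq1.le)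
    calc _ = (‖c (s+1)‖ * q^(s+1)) * (‖c (s+1)‖ * q^(s+1)) := by ring
      _ ≤ _ := mul_le_of_le_one_left (by positivity) this
  have fin := aux_final (fun s => ‖c s‖) q hq0 hq1 (fun s => norm_nonneg _) hO hE hS hS2
  have T1 : ∑' s : ℕ, ‖c s‖ * r ^ (s * k + m) = r ^ m * (‖c 0‖ + ∑' s, ‖c (s+1)‖ * q^(s+1)) := by
    have e : (fun s => ‖c s‖ * r ^ (s * k + m)) = fun s => r ^ m * (‖c s‖ * q ^ s) := by
      ext s; rw [hq, ← pow_mul, pow_add, mul_comm s k]; ring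
    rw [e, tsum_mul_left, Summable.tsum_eq_zero_add]
    · simp
    · exact (summable_nat_add_iff 1).1 hS
  have T2 : ∑' s : ℕ, ‖c (s + 1)‖ ^ 2 * r ^ (2 * (s + 1) * k + 2 * m) = r ^ m * r ^ m * ∑' s, ‖c (s+1)‖^2 * q^(2*(s+1)) := by
    rw [← tsum_mul_left]; congr 1; ext s
    rw [hq, ← pow_mul, pow_add, mul_comm k]; ring
  rw [T1, T2]
  set X := ∑' s, ‖c (s+1)‖ * q^(s+1)
  set Y := ∑' s, ‖c (s+1)‖^2 * q^(2*(s+1))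
  have T3 : (1 / (r ^ m + ‖c 0‖ * r ^ m) + r ^ (k - m) / (1 - q)) * (r ^ m * r ^ m * Y)
      = r ^ m * ((1/(1+‖c 0‖) + q/(1-q)) * Y) := by
    by_cases h0 : r ^ m = 0
    · simp [h0]
    · have : r ^ (k-m) * r ^ m = q := by rw [hq, ← pow_add]; congr 1; omega
      rw [← this, show r ^ m + ‖c 0‖ * r ^ m = r ^ m * (1 + ‖c 0‖) by ring]
      rw [this]
      have : 1 + ‖c 0‖ ≠ 0 := by positivity
      have e2 : r ^ (k-m) = q / r ^ m := by field_simp; linarith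
      rw [e2]
      field_simp
  rw [T3]
  have hrm : 0 ≤ r ^ m := by positivity
  calc r ^ m * (‖c 0‖ + X) + r ^ m * ((1/(1+‖c 0‖) + q/(1-q)) * Y)
      = r ^ m * (‖c 0‖ + (X + (1/(1+‖c 0‖) + q/(1-q)) * Y)) := by ring
    _ ≤ r ^ m * (‖c 0‖ + (1 - ‖c 0‖^2) * q/(1-q)) := by gcongr
    _ = (r ^ m * ‖c 0‖ * (1-q) + r ^ m * (1 - ‖c 0‖^2) * q) / (1-q) := by field_simp
    _ ≤ 1 := by
      rw [div_le_one h1]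
      rw [pow_add, ← hq] at hroot
      linarith
end
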